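/- Let T : X → X be an open, distance expanding, topologically transitive map of a compact metric space, let φ : X → ℝ be continuous, and let ν be a Borel probability measure with L*_φ ν = λ ν for some λ > 0. Then P_top(T, φ) ≤ log λ. -/

import Mathlib

open MeasureTheory Filter Set Topology
open scoped ENNReal NNReal



section MetricDefs

variable {X : Type*} [MetricSpace X] [MeasurableSpace X] [BorelSpace X]

/-- `T` is distance expanding: there are `λ > 1` and `η > 0` with
`d(x,y) < 2η → d(Tx,Ty) ≥ λ d(x,y)`. -/
def DistanceExpanding (T : X → X) : Prop :=
  ∃ lam η : ℝ, 1 < lam ∧ 0 < η ∧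
    ∀ x y : X, dist x y < 2 * η → lam * dist x y ≤ dist (T x) (T y)

/-- Topological transitivity. -/
def TopTransitive (T : X → X) : Prop :=
  ∀ U V : Set X, IsOpen U → IsOpen V → U.Nonempty → V.Nonempty →
    ∃ n : ℕ, (T^[n] '' U ∩ V).Nonempty

/-- Topological exactness. -/
def TopExact (T : X → X) : Prop :=
  ∀ U : Set X, IsOpen U → U.Nonempty → ∃ N : ℕ, T^[N] '' U = Set.univ

/-- Ruelle–Perron–Frobenius transfer operator `L_φ g (x) = ∑_{T y = x} e^{φ y} g y`. -/
noncomputable def transferOp (T : X → X) (φ : X → ℝ) (g : X → ℝ) (x : X) : ℝ :=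
  ∑' y : (T ⁻¹' {x} : Set X), Real.exp (φ y) * g y

/-- `ν` is a `φ`-conformal measure with eigenvalue `lam`: `L_φ^* ν = lam • ν`. -/
def IsConformal (T : X → X) (φ : X → ℝ) (ν : Measure X) (lam : ℝ) : Prop :=
  0 < lam ∧ ∀ g : C(X, ℝ), ∫ x, transferOp T φ (⇑g) x ∂ν = lam * ∫ x, g x ∂ν

/-- Birkhoff sum `S_n φ (x)`. -/
noncomputable def birkhoff (T : X → X) (φ : X → ℝ) (n : ℕ) (x : X) : ℝ :=
  ∑ j ∈ Finset.range n, φ (T^[j] x)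

/-- The empirical probability measures `σ_n(x) = (1/n) ∑_{j<n} δ_{T^j x}` (with the
irrelevant convention `σ_0(x) = δ_x`). -/
noncomputable def empirical (T : X → X) (x : X) (n : ℕ) : ProbabilityMeasure X :=
  if h : n = 0 then ⟨Measure.dirac x, inferInstance⟩
  else ⟨(n : ℝ≥0∞)⁻¹ • ∑ j ∈ Finset.range n, Measure.dirac (T^[j] x), by
    constructor
    rw [Measure.smul_apply, Measure.finset_sum_apply]
    simp [ENNReal.inv_mul_cancel, h]⟩

/-- `μ` is a `T`-invariant (Borel probability) measure. -/
def InvariantProb (T : X → X) (μ : ProbabilityMeasure X) : Prop :=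
  (μ : Measure X).map T = (μ : Measure X)

/-- The set `pω(x)` of weak* limit points of the empirical measures of `x`. -/
def pOmega (T : X → X) (x : X) : Set (ProbabilityMeasure X) :=
  {μ | MapClusterPt μ atTop (empirical T x)}

/-- `dP` is a metric on the space of Borel probability measures which is compatible with
the weak* topology. -/
def IsWeakStarMetric (dP : ProbabilityMeasure X → ProbabilityMeasure X → ℝ) : Prop :=
  (∀ μ ν, dP μ ν = dP ν μ) ∧ (∀ μ ν, dP μ ν = 0 ↔ μ = ν) ∧
  (∀ μ ν ρ, dP μ ρ ≤ dP μ ν + dP ν ρ) ∧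
  (∀ μ : ProbabilityMeasure X, ∀ s : Set (ProbabilityMeasure X),
      s ∈ nhds μ ↔ ∃ ε > 0, {ρ | dP ρ μ < ε} ⊆ s)

/-- The basin `A_ε(μ)` of `ε`-weak statistical attraction of `μ`. -/
noncomputable def Abasin (T : X → X) (dP : ProbabilityMeasure X → ProbabilityMeasure X → ℝ)
    (μ : ProbabilityMeasure X) (ε : ℝ) : Set X :=
  {x | sInf ((fun ρ => dP ρ μ) '' pOmega T x) < ε}

/-- The ergodic basin `B(μ) = {x : pω(x) = {μ}}`. -/
def Bbasin (T : X → X) (μ : ProbabilityMeasure X) : Set X :=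
  {x | pOmega T x = {μ}}

/-- The `ε`-pseudo basin `A_{ε,n}(μ)` of `μ` up to time `n`. -/
noncomputable def Apseudo (T : X → X) (dP : ProbabilityMeasure X → ProbabilityMeasure X → ℝ)
    (μ : ProbabilityMeasure X) (ε : ℝ) (n : ℕ) : Set X :=
  {x | dP (empirical T x n) μ < ε}

/-- `μ` is `ν`-SRB (`ν`-physical). -/
def IsSRB (T : X → X) (ν : Measure X) (μ : ProbabilityMeasure X) : Prop :=
  InvariantProb T μ ∧ 0 < ν (Bbasin T μ)

/-- `μ` is `ν`-SRB-like (`ν`-physical-like). -/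
def IsSRBLike (T : X → X) (ν : Measure X) (dP : ProbabilityMeasure X → ProbabilityMeasure X → ℝ)
    (μ : ProbabilityMeasure X) : Prop :=
  InvariantProb T μ ∧ ∀ ε > 0, 0 < ν (Abasin T dP μ ε)

/-- `μ` is `ν`-weak-SRB-like: `limsup (1/n) log ν(A_{ε,n}(μ)) = 0` for all `ε > 0`. -/
def IsWeakSRBLike (T : X → X) (ν : Measure X)
    (dP : ProbabilityMeasure X → ProbabilityMeasure X → ℝ) (μ : ProbabilityMeasure X) : Prop :=
  InvariantProb T μ ∧ ∀ ε > 0,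
    Filter.limsup
      (fun n : ℕ => (((n : ℝ)⁻¹ : ℝ) : EReal) * ENNReal.log (ν (Apseudo T dP μ ε n)))
      Filter.atTop = 0

/-- The entropy of the `n`-th dynamical refinement of the finite partition `P`
with respect to `μ`. -/
noncomputable def dynEnt (T : X → X) (μ : Measure X) {k : ℕ} (P : Fin k → Set X) (n : ℕ) : ℝ :=
  ∑ c : Fin n → Fin k, Real.negMulLog (μ (⋂ j : Fin n, T^[(j : ℕ)] ⁻¹' P (c j))).toReal

/-- Measure-theoretic (Kolmogorov–Sinai) entropy `h_μ(T)`: the supremum over finite Borel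
partitions `P` of `lim_n (1/n) H(⋁_{j<n} T^{-j} P, μ)`. -/
noncomputable def metricEntropy (T : X → X) (μ : Measure X) : EReal :=
  ⨆ (k : ℕ) (P : Fin k → Set X) (_ : ∀ i, MeasurableSet (P i))
      (_ : Pairwise (Function.onFun Disjoint P)) (_ : ⋃ i, P i = Set.univ),
    Filter.liminf (fun n : ℕ => (((n : ℝ)⁻¹ * dynEnt T μ P n : ℝ) : EReal)) Filter.atTop

/-- `E` is an `(n, ε)`-separated set. -/
def IsSeparated (T : X → X) (n : ℕ) (ε : ℝ) (E : Set X) : Prop :=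
  ∀ x ∈ E, ∀ y ∈ E, x ≠ y → ∃ j < n, ε < dist (T^[j] x) (T^[j] y)

/-- `sup { ∑_{x ∈ E} e^{S_n φ(x)} : E (n,ε)-separated }`. -/
noncomputable def presSum (T : X → X) (φ : X → ℝ) (n : ℕ) (ε : ℝ) : ℝ≥0∞ :=
  ⨆ (E : Finset X) (_ : IsSeparated T n ε ↑E), ∑ x ∈ E, ENNReal.ofReal (Real.exp (birkhoff T φ n x))

/-- Topological pressure of `φ` (via `(n,ε)`-separated sets). -/
noncomputable def topPressure (T : X → X) (φ : X → ℝ) : EReal :=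
  Filter.limsup (fun ε : ℝ =>
      Filter.limsup (fun n : ℕ => (((n : ℝ)⁻¹ : ℝ) : EReal) * ENNReal.log (presSum T φ n ε))
        Filter.atTop)
    (nhdsWithin (0 : ℝ) (Set.Ioi 0))

/-- `μ` is an equilibrium state for the potential `φ`:
`h_μ(T) + ∫ φ dμ = P_top(T, φ)`. -/
def IsEquilibrium (T : X → X) (φ : X → ℝ) (μ : ProbabilityMeasure X) : Prop :=
  InvariantProb T μ ∧
    metricEntropy T (μ : Measure X) + ((∫ x, φ x ∂(μ : Measure X) : ℝ) : EReal) = topPressure T φ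

/-- `K_r(φ)`: invariant measures with `h_μ(T) + ∫φ dμ ≥ P_top(T,φ) - r`. -/
def Kset (T : X → X) (φ : X → ℝ) (r : ℝ) : Set (ProbabilityMeasure X) :=
  {μ | InvariantProb T μ ∧
    topPressure T φ - (r : EReal) ≤
      metricEntropy T (μ : Measure X) + ((∫ x, φ x ∂(μ : Measure X) : ℝ) : EReal)}

/-- The dynamical ball `B(x, n, δ)`. -/
def dynBall (T : X → X) (x : X) (n : ℕ) (δ : ℝ) : Set X :=
  {y | ∀ j < n, dist (T^[j] x) (T^[j] y) ≤ δ}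

/-- The local entropy `h_ν(T,x) = lim_{δ→0} limsup_n -(1/n) log ν(B(x,n,δ))`. -/
noncomputable def localEntropy (T : X → X) (ν : Measure X) (x : X) : EReal :=
  Filter.limsup (fun δ : ℝ =>
      Filter.limsup
        (fun n : ℕ => (((n : ℝ)⁻¹ : ℝ) : EReal) * (- ENNReal.log (ν (dynBall T x n δ))))
        Filter.atTop)
    (nhdsWithin (0 : ℝ) (Set.Ioi 0))

/-- `h_ν(T,μ)`: the `μ`-essential supremum of `x ↦ h_ν(T,x)`. -/
noncomputable def localEntropySup (T : X → X) (ν : Measure X) (μ : Measure X) : EReal :=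
  essSup (localEntropy T ν) μ

/-- `c` is an ergodic decomposition of the `T`-invariant measure `μ`. -/
def IsErgodicDecomp (T : X → X) (μ : ProbabilityMeasure X) (c : X → ProbabilityMeasure X) : Prop :=
  Measurable (fun x => (c x : Measure X)) ∧
  (∀ᵐ x ∂(μ : Measure X), Ergodic T ((c x) : Measure X)) ∧
  (∀ A : Set X, MeasurableSet A → (μ : Measure X) A = ∫⁻ x, (c x : Measure X) A ∂(μ : Measure X))

/-- A probability measure is atomic if it is supported on a finite set. -/
def IsAtomicMeasure (μ : ProbabilityMeasure X) : Prop :=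
  ∃ S : Set X, S.Finite ∧ (μ : Measure X) S = 1

end MetricDefs

lemma birkhoff_succ {X : Type*} {T : X → X} {φ : X → ℝ} (n : ℕ) (x : X) :
    birkhoff T φ (n + 1) x = birkhoff T φ n x + φ (T^[n] x) :=
  Finset.sum_range_succ _ _

lemma abs_birkhoff_sub_le {X : Type*} [MetricSpace X] {T : X → X} {φ : X → ℝ} {δ s : ℝ}
    (hδ : ∀ x y, dist x y < s → |φ x - φ y| ≤ δ) {n : ℕ} {y z : X}
    (h : ∀ j < n, dist (T^[j] y) (T^[j] z) < s) :
    |birkhoff T φ n y - birkhoff T φ n z| ≤ n * δ := by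
  rw [birkhoff, birkhoff, ← Finset.sum_sub_distrib]
  refine (Finset.abs_sum_le_sum_abs _ _).trans ?_
  refine (Finset.sum_le_sum fun j hj => hδ _ _ (h j (Finset.mem_range.1 hj))).trans ?_
  simp

section InverseBranches

variable {X : Type*} [MetricSpace X] {T : X → X}

/-- A continuous open map of a compact space is uniformly open. -/
lemma IsOpenMap.exists_ball_subset_image_ball [CompactSpace X] (hopen : IsOpenMap T)
    (hcont : Continuous T) {η : ℝ} (hη : 0 < η) : ∃ r > 0, ∀ y, Metric.ball (T y) r ⊆ T '' Metric.ball y η := by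
  suffices h : ∃ r > 0, ∀ y ∈ (univ : Set X), Metric.ball (T y) r ⊆ T '' Metric.ball y η by
    simpa using h
  refine isCompact_univ.induction_on
    (p := fun S => ∃ r > 0, ∀ y ∈ S, Metric.ball (T y) r ⊆ T '' Metric.ball y η) ?_ ?_ ?_ ?_
  · exact ⟨1, one_pos, by simp⟩
  · rintro s t hst ⟨r, hr, h⟩
    exact ⟨r, hr, fun y hy => h y (hst hy)⟩
  · rintro s t ⟨r, hr, h⟩ ⟨r', hr', h'⟩
    refine ⟨min r r', lt_min hr hr', ?_⟩
    rintro y (hy | hy)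
    · exact (Metric.ball_subset_ball (min_le_left _ _)).trans (h y hy)
    · exact (Metric.ball_subset_ball (min_le_right _ _)).trans (h' y hy)
  · intro y _
    obtain ⟨s, hs, hsub⟩ := Metric.isOpen_iff.1 (hopen _ (Metric.isOpen_ball (x := y) (ε := η / 2)))
      (T y) (mem_image_of_mem T (Metric.mem_ball_self (half_pos hη)))
    refine ⟨Metric.ball y (η / 2) ∩ T ⁻¹' Metric.ball (T y) (s / 2), ?_, s / 2, half_pos hs, ?_⟩
    · rw [nhdsWithin_univ]
      exact inter_mem (Metric.ball_mem_nhds _ (half_pos hη))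
        (hcont.continuousAt.preimage_mem_nhds (Metric.ball_mem_nhds _ (half_pos hs)))
    · rintro y' ⟨hy', hTy'⟩
      refine (Metric.ball_subset_ball' ?_).trans (hsub.trans (image_mono (Metric.ball_subset_ball' ?_)))
      · have : dist (T y') (T y) < s / 2 := hTy'
        linarith
      · have : dist y y' < η / 2 := by simpa [dist_comm] using hy'
        linarith

/-- Local inverse branches of an open distance expanding map. -/
lemma DistanceExpanding.exists_inverse_branch [CompactSpace X] (hde : DistanceExpanding T)
    (hcont : Continuous T) (hopen : IsOpenMap T) :
    ∃ κ > (1 : ℝ), ∃ η > (0 : ℝ), ∃ r > (0 : ℝ), (∀ x y, T x = T y → dist x y < 2 * η → x = y) ∧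
      ∀ y x, dist (T y) x < r → ∃ z, T z = x ∧ dist y z < η ∧ κ * dist y z ≤ dist (T y) x := by
  obtain ⟨κ, η, hκ, hη, hexp⟩ := hde
  obtain ⟨r, hr, hball⟩ := hopen.exists_ball_subset_image_ball hcont hη
  refine ⟨κ, hκ, η, hη, r, hr, fun x y hxy hd => ?_, fun y x hx => ?_⟩
  · have := hexp x y hd
    rw [hxy, dist_self] at this
    exact dist_le_zero.1 (nonpos_of_mul_nonpos_right this (by linarith))
  · obtain ⟨z, hz, rfl⟩ := hball y (Metric.mem_ball'.2 hx)
    have hz' : dist y z < η := Metric.mem_ball'.1 hz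
    exact ⟨z, rfl, hz', hexp y z (by linarith)⟩

lemma exists_iterate_inverse_branch {κ η r : ℝ} (hκ : 1 < κ)
    (hbr : ∀ y x, dist (T y) x < r → ∃ z, T z = x ∧ dist y z < η ∧ κ * dist y z ≤ dist (T y) x)
    (n : ℕ) (y x : X) (hx : dist (T^[n] y) x < r) :
    ∃ z, T^[n] z = x ∧ κ ^ n * dist y z ≤ dist (T^[n] y) x ∧
      ∀ j ≤ n, dist (T^[j] y) (T^[j] z) ≤ dist (T^[n] y) x := by
  induction n generalizing x with
  | zero => exact ⟨x, rfl, by simp, fun j hj => by simp [Nat.le_zero.1 hj]⟩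
  | succ n ih =>
    rw [Function.iterate_succ_apply'] at hx ⊢
    obtain ⟨w, rfl, -, hw⟩ := hbr _ _ hx
    have hd : dist (T^[n] y) w ≤ dist (T (T^[n] y)) (T w) := by
      nlinarith [dist_nonneg (x := T^[n] y) (y := w)]
    obtain ⟨z, rfl, hz, hzj⟩ := ih w (hd.trans_lt hx)
    refine ⟨z, Function.iterate_succ_apply' T n z, ?_, fun j hj => ?_⟩
    · rw [pow_succ', mul_assoc]
      exact (mul_le_mul_of_nonneg_left hz (by linarith)).trans hw
    · rcases hj.lt_or_eq with h | rfl
      · exact (hzj j (Nat.lt_succ_iff.1 h)).trans hd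
      · simp only [Function.iterate_succ_apply', le_refl]

lemma finite_fiber_of_separated [CompactSpace X] (hcont : Continuous T) {η : ℝ} (hη : 0 < η)
    (hinj : ∀ x y, T x = T y → dist x y < 2 * η → x = y) (x : X) : Finite (T ⁻¹' {x} : Set X) := by
  have : DiscreteTopology (T ⁻¹' {x} : Set X) := by
    refine DiscreteTopology.of_forall_le_dist (r := 2 * η) (by linarith) fun a b hab => ?_
    by_contra! h
    exact hab (Subtype.ext (hinj a b (by rw [a.2, b.2]) h))
  have : CompactSpace (T ⁻¹' {x} : Set X) :=
    isCompact_iff_compactSpace.1 (isClosed_singleton.preimage hcont).isCompact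
  exact finite_of_compact_of_discrete

/-- Fibers over nearby points correspond bijectively with small displacement. -/
lemma exists_fiber_equiv {κ η r : ℝ} (hκ : 1 < κ)
    (hinj : ∀ x y, T x = T y → dist x y < 2 * η → x = y)
    (hbr : ∀ y x, dist (T y) x < r → ∃ z, T z = x ∧ dist y z < η ∧ κ * dist y z ≤ dist (T y) x)
    {x x' : X} (hx : dist x x' < r) :
    ∃ e : (T ⁻¹' {x} : Set X) ≃ (T ⁻¹' {x'} : Set X),
      ∀ y : (T ⁻¹' {x} : Set X), dist (y : X) (e y) ≤ dist x x' := by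
  have key : ∀ u v : X, dist u v < r → ∃ f : (T ⁻¹' {u} : Set X) → (T ⁻¹' {v} : Set X),
      ∀ y : (T ⁻¹' {u} : Set X), dist (y : X) (f y) < η ∧ dist (y : X) (f y) ≤ dist u v := by
    intro u v huv
    choose f hf using fun y : (T ⁻¹' {u} : Set X) =>
      hbr y v (by rw [show T y = u from y.2]; exact huv)
    refine ⟨fun y => ⟨f y, (hf y).1⟩, fun y => ⟨(hf y).2.1, ?_⟩⟩
    have h := (hf y).2.2
    rw [show T y = u from y.2] at h
    have := dist_nonneg (x := (y : X)) (y := f y)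
    show dist (y : X) (f y) ≤ _
    nlinarith
  obtain ⟨f, hf⟩ := key x x' hx
  obtain ⟨g, hg⟩ := key x' x (by rwa [dist_comm])
  refine ⟨⟨f, g, fun y => Subtype.ext (hinj _ _ ?_ ?_), fun y => Subtype.ext (hinj _ _ ?_ ?_)⟩,
    fun y => (hf y).2⟩
  · rw [show T (g (f y)) = x from (g (f y)).2, show T y = x from y.2]
  · have h1 := (hf y).1
    have h2 := (hg (f y)).1
    rw [dist_comm]
    linarith [dist_triangle (y : X) (f y) (g (f y))]
  · rw [show T (f (g y)) = x' from (f (g y)).2, show T y = x' from y.2]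
  · have h1 := (hg y).1
    have h2 := (hf (g y)).1
    rw [dist_comm]
    linarith [dist_triangle (y : X) (g y) (f (g y))]

lemma DistanceExpanding.finite_fiber [CompactSpace X] (hde : DistanceExpanding T)
    (hcont : Continuous T) (hopen : IsOpenMap T) (x : X) : Finite (T ⁻¹' {x} : Set X) := by
  obtain ⟨-, -, η, hη, -, -, hinj, -⟩ := hde.exists_inverse_branch hcont hopen
  exact finite_fiber_of_separated hcont hη hinj x

lemma DistanceExpanding.continuous_tsum_fiber [CompactSpace X] (hde : DistanceExpanding T)
    (hcont : Continuous T) (hopen : IsOpenMap T) {f : X → ℝ} (hf : Continuous f) :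
    Continuous fun x => ∑' y : (T ⁻¹' {x} : Set X), f y := by
  obtain ⟨κ, hκ, η, hη, r, hr, hinj, hbr⟩ := hde.exists_inverse_branch hcont hopen
  refine Metric.continuous_iff.2 fun x ε hε => ?_
  have := hde.finite_fiber hcont hopen x
  have := Fintype.ofFinite (T ⁻¹' {x} : Set X)
  set N := ((Fintype.card (T ⁻¹' {x} : Set X) : ℕ) : ℝ) with hN_def
  have hN : 0 ≤ N := Nat.cast_nonneg _
  obtain ⟨δ, hδ, hfδ⟩ := Metric.uniformContinuous_iff.1
    (CompactSpace.uniformContinuous_of_continuous hf) (ε / (N + 1)) (by positivity)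
  refine ⟨min δ r, lt_min hδ hr, fun x' hx' => ?_⟩
  rw [dist_comm] at hx'
  obtain ⟨e, he⟩ := exists_fiber_equiv hκ hinj hbr (hx'.trans_le (min_le_right _ _))
  rw [← e.tsum_eq (fun y : (T ⁻¹' {x'} : Set X) => f y), tsum_fintype, tsum_fintype]
  calc dist (∑ y, f (e y)) (∑ y : (T ⁻¹' {x} : Set X), f y)
      ≤ ∑ y : (T ⁻¹' {x} : Set X), dist (f (e y)) (f y) := dist_sum_sum_le _ _ _
    _ ≤ ∑ y : (T ⁻¹' {x} : Set X), ε / (N + 1) := by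
        refine Finset.sum_le_sum fun y _ => (hfδ ?_).le
        rw [dist_comm]
        exact (he y).trans_lt (hx'.trans_le (min_le_left _ _))
    _ = N * (ε / (N + 1)) := by simp [hN_def]
    _ < ε := by
        rw [mul_div_assoc', div_lt_iff₀ (by positivity)]
        nlinarith

lemma isOpenMap_iterate {Y : Type*} [TopologicalSpace Y] {f : Y → Y} (hf : IsOpenMap f) (n : ℕ) :
    IsOpenMap f^[n] := by
  induction n with
  | zero => exact IsOpenMap.id
  | succ n ih => exact ih.comp hf

/-- A closed ball of positive radius sweeps out the whole space under iteration. -/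
lemma TopTransitive.exists_iterate_mem_closedBall [CompactSpace X] (htr : TopTransitive T)
    (hcont : Continuous T) (hopen : IsOpenMap T) (hde : DistanceExpanding T) (x : X)
    {s : ℝ} (hs : 0 < s) (y : X) :
    ∃ n, ∃ z ∈ Metric.closedBall x s, T^[n] z = y := by
  obtain ⟨κ, hκ, η, -, r, hr, -, hbr⟩ := hde.exists_inverse_branch hcont hopen
  obtain ⟨N, hN⟩ := pow_unbounded_of_one_lt (r / (s / 2)) hκ
  rw [div_lt_iff₀ (half_pos hs)] at hN
  obtain ⟨n, v, ⟨-, ⟨w, hw, rfl⟩, rfl⟩, hv⟩ := htr (T^[N] '' Metric.ball x (s / 2)) (Metric.ball y r)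
    (isOpenMap_iterate hopen N _ Metric.isOpen_ball) Metric.isOpen_ball
    ⟨_, mem_image_of_mem _ (Metric.mem_ball_self (half_pos hs))⟩ ⟨y, Metric.mem_ball_self hr⟩
  rw [← Function.iterate_add_apply] at hv
  obtain ⟨z, hz, hd, -⟩ := exists_iterate_inverse_branch hκ hbr (n + N) w y hv
  refine ⟨n + N, z, ?_, hz⟩
  have h1 : κ ^ N * dist w z < κ ^ N * (s / 2) :=
    calc κ ^ N * dist w z ≤ κ ^ (n + N) * dist w z :=
          mul_le_mul_of_nonneg_right (pow_le_pow_right₀ hκ.le (Nat.le_add_left _ _)) dist_nonneg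
      _ < κ ^ N * (s / 2) := (hd.trans_lt hv).trans hN
  have h2 : dist w z < s / 2 := lt_of_mul_lt_mul_left h1 (by positivity)
  have h3 : dist w x < s / 2 := hw
  rw [Metric.mem_closedBall]
  linarith [dist_triangle_left z x w]

end InverseBranches

section ConformalMeasure

variable {X : Type*} [MetricSpace X] [CompactSpace X] [MeasurableSpace X]
  {T : X → X} {φ : X → ℝ} {lam : ℝ}

/-- The `n`-th iterate of the transfer operator applied to a nonnegative continuous function `g`
has integral `lam ^ n * ∫ g` and dominates each of its summands. -/
lemma IsConformal.exists_iterate {ν : Measure X} (hν : IsConformal T φ ν lam)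
    (hcont : Continuous T) (hopen : IsOpenMap T) (hde : DistanceExpanding T) (hφ : Continuous φ)
    (g : C(X, ℝ)) (hg : ∀ x, 0 ≤ g x) (n : ℕ) :
    ∃ G : C(X, ℝ), (∀ x, 0 ≤ G x) ∧ ∫ x, G x ∂ν = lam ^ n * ∫ x, g x ∂ν ∧
      ∀ z, Real.exp (birkhoff T φ n z) * g z ≤ G (T^[n] z) := by
  induction n with
  | zero => exact ⟨g, hg, by simp, fun z => by simp [birkhoff]⟩
  | succ n ih =>
    obtain ⟨G, hG0, hGint, hG⟩ := ih
    have hterm : ∀ y, 0 ≤ Real.exp (φ y) * G y := fun y => mul_nonneg (Real.exp_nonneg _) (hG0 y)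
    refine ⟨⟨transferOp T φ G, hde.continuous_tsum_fiber hcont hopen
      ((Real.continuous_exp.comp hφ).mul G.continuous)⟩,
      fun x => tsum_nonneg fun y => hterm y, ?_, fun z => ?_⟩
    · rw [pow_succ', mul_assoc, ← hGint]
      exact hν.2 G
    · have := hde.finite_fiber hcont hopen (T^[n + 1] z)
      have hle := (Summable.of_finite (L := .unconditional _)
        (f := fun y : (T ⁻¹' {T^[n + 1] z} : Set X) => Real.exp (φ y) * G y)).le_tsum
        ⟨T^[n] z, (Function.iterate_succ_apply' T n z).symm⟩ fun y _ => hterm y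
      refine le_trans ?_ hle
      rw [birkhoff_succ, Real.exp_add, mul_comm (Real.exp (birkhoff T φ n z)), mul_assoc]
      exact mul_le_mul_of_nonneg_left (hG z) (Real.exp_nonneg _)

/-- If every point of `B` has an `n`-th preimage in the closed set `K` along which the Birkhoff
sum is at least `a`, then `exp a * ν B ≤ lam ^ n * ν U` for every open `U ⊇ K`. -/
lemma IsConformal.exp_mul_measureReal_le [BorelSpace X] {ν : Measure X} [IsProbabilityMeasure ν]
    (hν : IsConformal T φ ν lam)
    (hcont : Continuous T) (hopen : IsOpenMap T) (hde : DistanceExpanding T) (hφ : Continuous φ)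
    {K U B : Set X} (hK : IsClosed K) (hU : IsOpen U) (hKU : K ⊆ U) {n : ℕ} {a : ℝ}
    (h : ∀ x ∈ B, ∃ z ∈ K, T^[n] z = x ∧ a ≤ birkhoff T φ n z) :
    Real.exp a * ν.real B ≤ lam ^ n * ν.real U := by
  obtain ⟨g, hg0, hg1, hg⟩ := exists_continuous_zero_one_of_isClosed hU.isClosed_compl hK
    (disjoint_compl_left_iff_subset.2 hKU)
  have hint : ∀ f : C(X, ℝ), Integrable f ν := fun f =>
    f.continuous.integrable_of_hasCompactSupport (HasCompactSupport.of_compactSpace _)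
  obtain ⟨G, hG0, hGint, hG⟩ := hν.exists_iterate hcont hopen hde hφ g (fun x => (hg x).1) n
  calc Real.exp a * ν.real B ≤ Real.exp a * ν.real {x | Real.exp a ≤ G x} := by
        refine mul_le_mul_of_nonneg_left (measureReal_mono fun x hx => ?_) (Real.exp_nonneg _)
        obtain ⟨z, hzK, rfl, hz⟩ := h x hx
        have := hG z
        rw [hg1 hzK, Pi.one_apply, mul_one] at this
        exact (Real.exp_le_exp.2 hz).trans this
    _ ≤ ∫ x, G x ∂ν := mul_meas_ge_le_integral_of_nonneg (ae_of_all _ hG0) (hint G) _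
    _ = lam ^ n * ∫ x, g x ∂ν := hGint
    _ ≤ lam ^ n * ν.real U := by
        refine mul_le_mul_of_nonneg_left ?_ (pow_nonneg hν.1.le _)
        rw [← integral_indicator_one hU.measurableSet]
        refine integral_mono (hint g) ((integrable_const (1 : ℝ)).indicator hU.measurableSet)
          fun x => ?_
        by_cases hx : x ∈ U
        · simpa [hx] using (hg x).2
        · simpa [hx] using (hg0 hx).le

lemma IsConformal.measureReal_ball_pos [BorelSpace X] {ν : Measure X} [IsProbabilityMeasure ν]
    (hν : IsConformal T φ ν lam) (hcont : Continuous T) (hopen : IsOpenMap T)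
    (hde : DistanceExpanding T) (htr : TopTransitive T) (hφ : Continuous φ) (x : X) {s : ℝ}
    (hs : 0 < s) : 0 < ν.real (Metric.ball x s) := by
  by_contra! h0
  have h0 : ν.real (Metric.ball x s) = 0 := le_antisymm h0 measureReal_nonneg
  set K := Metric.closedBall x (s / 2)
  have hnull : ∀ n : ℕ, ν (T^[n] '' K) = 0 := by
    intro n
    obtain ⟨a, ha⟩ : ∃ a, ∀ z, a ≤ birkhoff T φ n z := by
      have : Continuous (birkhoff T φ n) :=
        continuous_finsetSum _ fun j _ => hφ.comp (hcont.iterate j)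
      obtain ⟨a, ha⟩ := (isCompact_range this).bddBelow
      exact ⟨a, fun z => ha (mem_range_self z)⟩
    have hle := hν.exp_mul_measureReal_le hcont hopen hde hφ (K := K) (B := T^[n] '' K) (n := n)
      (a := a) Metric.isClosed_closedBall Metric.isOpen_ball
      (Metric.closedBall_subset_ball (half_lt_self hs))
      (by rintro _ ⟨z, hz, rfl⟩; exact ⟨z, hz, rfl, ha z⟩)
    rw [h0, mul_zero] at hle
    exact (measureReal_eq_zero_iff).1
      (le_antisymm (nonpos_of_mul_nonpos_right hle (Real.exp_pos a)) measureReal_nonneg)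
  have huniv : ⋃ n : ℕ, T^[n] '' K = univ := by
    refine eq_univ_of_forall fun y => mem_iUnion.2 ?_
    exact htr.exists_iterate_mem_closedBall hcont hopen hde x (half_pos hs) y
  have := measure_iUnion_null hnull
  rw [huniv, measure_univ] at this
  exact one_ne_zero this

lemma exists_forall_le_measureReal_ball {ν : Measure X} [IsFiniteMeasure ν] {s : ℝ}
    (hs : 0 < s) (hν : ∀ x, 0 < ν.real (Metric.ball x (s / 2))) :
    ∃ c > 0, ∀ x, c ≤ ν.real (Metric.ball x s) := by
  suffices h : ∃ c > 0, ∀ x ∈ (univ : Set X), c ≤ ν.real (Metric.ball x s) by simpa using h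
  refine isCompact_univ.induction_on
    (p := fun S => ∃ c > 0, ∀ x ∈ S, c ≤ ν.real (Metric.ball x s)) ?_ ?_ ?_ ?_
  · exact ⟨1, one_pos, by simp⟩
  · rintro S S' hS ⟨c, hc, h⟩
    exact ⟨c, hc, fun y hy => h y (hS hy)⟩
  · rintro S S' ⟨c, hc, h⟩ ⟨c', hc', h'⟩
    refine ⟨min c c', lt_min hc hc', ?_⟩
    rintro y (hy | hy)
    · exact (min_le_left _ _).trans (h y hy)
    · exact (min_le_right _ _).trans (h' y hy)
  · intro x _
    refine ⟨Metric.ball x (s / 2), mem_nhdsWithin_of_mem_nhds (Metric.ball_mem_nhds _ (half_pos hs)),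
      _, hν x, fun y hy => measureReal_mono (Metric.ball_subset_ball' ?_)⟩
    have : dist x y < s / 2 := Metric.mem_ball'.1 hy
    linarith

/-- Partition sums over separated sets grow at most like `lam ^ n`, up to a subexponential
factor. -/
lemma IsConformal.exists_presSum_le [BorelSpace X] {ν : Measure X} [IsProbabilityMeasure ν]
    (hν : IsConformal T φ ν lam) (hcont : Continuous T) (hopen : IsOpenMap T)
    (hde : DistanceExpanding T) (htr : TopTransitive T) (hφ : Continuous φ) {ε δ : ℝ}
    (hε : 0 < ε) (hδ : 0 < δ) :
    ∃ C > 0, ∀ n : ℕ, presSum T φ n ε ≤ ENNReal.ofReal (C * (lam * Real.exp δ) ^ n) := by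
  obtain ⟨κ, hκ, η, -, r, hr, -, hbr⟩ := hde.exists_inverse_branch hcont hopen
  obtain ⟨s₀, hs₀, hφs⟩ := Metric.uniformContinuous_iff.1
    (CompactSpace.uniformContinuous_of_continuous hφ) δ hδ
  set s := min (min r s₀) (ε / 4)
  have hs : 0 < s := lt_min (lt_min hr hs₀) (by positivity)
  have hsr : s ≤ r := (min_le_left _ _).trans (min_le_left _ _)
  have hss₀ : s ≤ s₀ := (min_le_left _ _).trans (min_le_right _ _)
  have hsε : s ≤ ε / 4 := min_le_right _ _
  obtain ⟨c, hc, hcball⟩ := exists_forall_le_measureReal_ball (ν := ν) hs fun x =>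
    hν.measureReal_ball_pos hcont hopen hde htr hφ x (half_pos hs)
  refine ⟨c⁻¹, inv_pos.2 hc, fun n => iSup₂_le fun E hE => ?_⟩
  let U : X → Set X := fun y => {z | ∀ j < n, dist (T^[j] y) (T^[j] z) < ε / 2}
  let K : X → Set X := fun y => {z | ∀ j < n, dist (T^[j] y) (T^[j] z) ≤ s}
  have hdist : ∀ y j, Continuous fun z => dist (T^[j] y) (T^[j] z) := fun y j =>
    continuous_const.dist (hcont.iterate j)
  have hK : ∀ y, IsClosed (K y) := fun y => by
    simp only [K, ofPred_forall]
    exact isClosed_iInter fun j => isClosed_iInter fun _ =>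
      isClosed_le (hdist y j) continuous_const
  have hU : ∀ y, IsOpen (U y) := fun y => by
    simp only [U, ofPred_forall]
    exact (finite_lt_nat n).isOpen_biInter fun j _ => isOpen_lt (hdist y j) continuous_const
  have hKU : ∀ y, K y ⊆ U y := fun y z hz j hj => (hz j hj).trans_lt (by linarith)
  have hmass : ∀ y, Real.exp (birkhoff T φ n y - n * δ) * c ≤ lam ^ n * ν.real (U y) := by
    intro y
    refine (mul_le_mul_of_nonneg_left (hcball (T^[n] y)) (Real.exp_nonneg _)).trans
      (hν.exp_mul_measureReal_le hcont hopen hde hφ (hK y) (hU y) (hKU y) fun x hx => ?_)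
    have hx : dist (T^[n] y) x < s := Metric.mem_ball'.1 hx
    obtain ⟨z, hz, -, hd⟩ := exists_iterate_inverse_branch hκ hbr n y x (hx.trans_le hsr)
    have hdz : ∀ j < n, dist (T^[j] y) (T^[j] z) < s := fun j hj => (hd j hj.le).trans_lt hx
    have := abs_le.1 (abs_birkhoff_sub_le (φ := φ) (fun a b hab => (hφs (hab.trans_le hss₀)).le) hdz)
    exact ⟨z, fun j hj => (hdz j hj).le, hz, by linarith⟩
  have hdisj : (E : Set X).PairwiseDisjoint U := by
    intro y hy y' hy' hne
    refine Set.disjoint_left.2 fun z hz hz' => ?_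
    obtain ⟨j, hj, hlt⟩ := hE y hy y' hy' hne
    linarith [hz j hj, hz' j hj, dist_triangle_right (T^[j] y) (T^[j] y') (T^[j] z)]
  have hsum : ∑ y ∈ E, ν.real (U y) ≤ 1 := by
    rw [← measureReal_biUnion_finset hdisj fun y _ => (hU y).measurableSet]
    exact measureReal_le_one
  rw [← ENNReal.ofReal_sum_of_nonneg fun _ _ => Real.exp_nonneg _]
  refine ENNReal.ofReal_le_ofReal ?_
  rw [inv_mul_eq_div, le_div_iff₀ hc, mul_pow, ← Real.exp_nat_mul, Finset.sum_mul]
  calc ∑ y ∈ E, Real.exp (birkhoff T φ n y) * c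
      ≤ ∑ y ∈ E, lam ^ n * Real.exp (n * δ) * ν.real (U y) := by
        refine Finset.sum_le_sum fun y _ => ?_
        have := mul_le_mul_of_nonneg_left (hmass y) (Real.exp_nonneg (n * δ))
        rw [← mul_assoc, ← Real.exp_add, add_sub_cancel] at this
        linarith
    _ ≤ lam ^ n * Real.exp (n * δ) := by
        rw [← Finset.mul_sum]
        exact mul_le_of_le_one_right
          (mul_nonneg (pow_nonneg hν.1.le _) (Real.exp_nonneg _)) hsum

end ConformalMeasure

/-- An exponential bound on a sequence in `ℝ≥0∞` bounds its exponential growth rate. -/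
lemma limsup_inv_mul_log_le {u : ℕ → ℝ≥0∞} {C b : ℝ} (hC : 0 < C) (hb : 0 < b)
    (hu : ∀ n, u n ≤ ENNReal.ofReal (C * b ^ n)) :
    limsup (fun n : ℕ => (((n : ℝ)⁻¹ : ℝ) : EReal) * ENNReal.log (u n)) atTop
      ≤ ((Real.log b : ℝ) : EReal) := by
  have hlim : Tendsto (fun n : ℕ => (((n : ℝ)⁻¹ * Real.log C + Real.log b : ℝ) : EReal)) atTop
      (𝓝 ((Real.log b : ℝ) : EReal)) := by
    refine (continuous_coe_real_ereal.tendsto _).comp ?_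
    simpa using ((tendsto_inv_atTop_nhds_zero_nat (𝕜 := ℝ)).mul_const (Real.log C)).add_const
      (Real.log b)
  rw [← hlim.limsup_eq]
  refine limsup_le_limsup ?_
  filter_upwards [eventually_gt_atTop 0] with n hn
  have hn : (0 : ℝ) < n := Nat.cast_pos.2 hn
  calc (((n : ℝ)⁻¹ : ℝ) : EReal) * ENNReal.log (u n)
      ≤ (((n : ℝ)⁻¹ : ℝ) : EReal) * ENNReal.log (ENNReal.ofReal (C * b ^ n)) :=
        mul_le_mul_of_nonneg_left (ENNReal.log_monotone (hu n))
          (EReal.coe_nonneg.2 (inv_nonneg.2 hn.le))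
    _ = (((n : ℝ)⁻¹ * Real.log C + Real.log b : ℝ) : EReal) := by
        rw [ENNReal.log_ofReal_of_pos (by positivity), ← EReal.coe_mul,
          Real.log_mul hC.ne' (by positivity), Real.log_pow]
        congr 1
        field_simp


/-- **Lemma.** If `L_φ^* ν = lam • ν` for an open distance expanding topologically
transitive map `T` and continuous `φ`, then `P_top(T, φ) ≤ log lam`. -/
theorem topPressure_le_log_eigenvalue
    {X : Type*} [MetricSpace X] [CompactSpace X] [MeasurableSpace X] [BorelSpace X]
    (T : X → X) (hcont : Continuous T) (hopen : IsOpenMap T)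
    (hde : DistanceExpanding T) (htr : TopTransitive T)
    (φ : X → ℝ) (hφ : Continuous φ)
    (ν : ProbabilityMeasure X) (lam : ℝ) (hν : IsConformal T φ (ν : Measure X) lam) :
    topPressure T φ ≤ ((Real.log lam : ℝ) : EReal) := by
  refine limsup_le_of_le ?_ ?_
  · isBoundedDefault
  filter_upwards [self_mem_nhdsWithin] with ε hε
  refine EReal.le_of_forall_lt_iff_le.1 fun z hz => ?_
  have hz : Real.log lam < z := EReal.coe_lt_coe_iff.1 hz
  obtain ⟨C, hC, hbound⟩ :=
    hν.exists_presSum_le hcont hopen hde htr hφ (mem_Ioi.1 hε) (sub_pos.2 hz)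
  have hrate := limsup_inv_mul_log_le hC (mul_pos hν.1 (Real.exp_pos _)) hbound
  rwa [Real.log_mul hν.1.ne' (Real.exp_pos _).ne', Real.log_exp, add_sub_cancel] at hrate
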